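/- Let b > 0, δ > 0, η > 0 be real constants and let v satisfy 0 ≤ v < (√5 − 1)/2. Let y : [0,1] × [0,∞) → ℝ be a sufficiently smooth (of class C³) solution of the PDE y_tt + 2δ y_t + 2v y_xt = (1 − v² + (3/2) b y_x²) y_xx + 2η y_x y_xx y_xt + η y_x² y_xxt on (0,1) × [0,∞) with boundary conditions y(0,t) = y(1,t) = 0 for all t ≥ 0. Then for every x ∈ [0,1], y(x,t) → 0 as t → ∞. -/

import Mathlib

open Real Filter

/-- Partial derivative with respect to the first (spatial) variable. -/
noncomputable def pdx (y : ℝ → ℝ → ℝ) (x t : ℝ) : ℝ := deriv (fun x' => y x' t) x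

/-- Partial derivative with respect to the second (time) variable. -/
noncomputable def pdt (y : ℝ → ℝ → ℝ) (x t : ℝ) : ℝ := deriv (fun t' => y x t') t

/-- Differentiation under the integral sign for a jointly continuous time derivative. -/
theorem hasDerivAt_integral_of_continuous_deriv {f f' : ℝ → ℝ → ℝ} {a b : ℝ}
    (hf : Continuous (Function.uncurry f)) (hf' : Continuous (Function.uncurry f'))
    (hd : ∀ x t, HasDerivAt (fun s => f x s) (f' x t) t) (t : ℝ) :
    HasDerivAt (fun s => ∫ x in a..b, f x s) (∫ x in a..b, f' x t) t := by
  obtain ⟨C, hC⟩ := ((isCompact_uIcc (a := a) (b := b)).prod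
    (isCompact_Icc (a := t - 1) (b := t + 1))).exists_bound_of_continuousOn hf'.continuousOn
  have hslice : ∀ {g : ℝ → ℝ → ℝ}, Continuous (Function.uncurry g) →
      ∀ s, Continuous (fun x => g x s) := fun hg s =>
    hg.comp (continuous_id.prodMk continuous_const)
  refine (intervalIntegral.hasDerivAt_integral_of_dominated_loc_of_deriv_le
    (F := fun s x => f x s) (F' := fun s x => f' x s) (bound := fun _ => C)
    (s := Set.Icc (t - 1) (t + 1)) (Icc_mem_nhds (by linarith) (by linarith))
    (Eventually.of_forall fun s => (hslice hf s).aestronglyMeasurable)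
    ((hslice hf t).intervalIntegrable _ _) (hslice hf' t).aestronglyMeasurable
    (Eventually.of_forall fun x hx s hs => ?_) intervalIntegrable_const
    (Eventually.of_forall fun x _ s _ => hd x s)).2
  exact hC (x, s) ⟨Set.uIoc_subset_uIcc hx, hs⟩

theorem hasDerivAt_pdx_fderiv {y : ℝ → ℝ → ℝ} (hy : Differentiable ℝ (Function.uncurry y))
    (x t : ℝ) :
    HasDerivAt (fun x' => y x' t) (fderiv ℝ (Function.uncurry y) (x, t) (1, 0)) x := by
  have h := (hy (x, t)).hasFDerivAt.comp_hasDerivAt x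
    ((hasDerivAt_id x).prodMk (hasDerivAt_const x t))
  exact h

theorem hasDerivAt_pdt_fderiv {y : ℝ → ℝ → ℝ} (hy : Differentiable ℝ (Function.uncurry y))
    (x t : ℝ) :
    HasDerivAt (fun t' => y x t') (fderiv ℝ (Function.uncurry y) (x, t) (0, 1)) t := by
  have h := (hy (x, t)).hasFDerivAt.comp_hasDerivAt t
    ((hasDerivAt_const t x).prodMk (hasDerivAt_id t))
  exact h

theorem hasDerivAt_pdx {y : ℝ → ℝ → ℝ} (hy : Differentiable ℝ (Function.uncurry y)) (x t : ℝ) :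
    HasDerivAt (fun x' => y x' t) (pdx y x t) x :=
  (hasDerivAt_pdx_fderiv hy x t).differentiableAt.hasDerivAt

theorem hasDerivAt_pdt {y : ℝ → ℝ → ℝ} (hy : Differentiable ℝ (Function.uncurry y)) (x t : ℝ) :
    HasDerivAt (fun t' => y x t') (pdt y x t) t :=
  (hasDerivAt_pdt_fderiv hy x t).differentiableAt.hasDerivAt

theorem uncurry_pdx {y : ℝ → ℝ → ℝ} (hy : Differentiable ℝ (Function.uncurry y)) :
    Function.uncurry (pdx y) = fun z => fderiv ℝ (Function.uncurry y) z (1, 0) := by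
  ext ⟨x, t⟩
  exact (hasDerivAt_pdx_fderiv hy x t).deriv

theorem uncurry_pdt {y : ℝ → ℝ → ℝ} (hy : Differentiable ℝ (Function.uncurry y)) :
    Function.uncurry (pdt y) = fun z => fderiv ℝ (Function.uncurry y) z (0, 1) := by
  ext ⟨x, t⟩
  exact (hasDerivAt_pdt_fderiv hy x t).deriv

theorem contDiff_pdx {y : ℝ → ℝ → ℝ} {n : ℕ}
    (hy : ContDiff ℝ (n + 1 : ℕ) (Function.uncurry y)) :
    ContDiff ℝ n (Function.uncurry (pdx y)) := by
  rw [uncurry_pdx (hy.differentiable (by simp))]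
  exact (hy.fderiv_right (m := n) (by simp)).clm_apply contDiff_const

theorem contDiff_pdt {y : ℝ → ℝ → ℝ} {n : ℕ}
    (hy : ContDiff ℝ (n + 1 : ℕ) (Function.uncurry y)) :
    ContDiff ℝ n (Function.uncurry (pdt y)) := by
  rw [uncurry_pdt (hy.differentiable (by simp))]
  exact (hy.fderiv_right (m := n) (by simp)).clm_apply contDiff_const

theorem pdt_pdx_eq_pdx_pdt {y : ℝ → ℝ → ℝ} (hy : ContDiff ℝ 2 (Function.uncurry y)) (x t : ℝ) :
    pdt (pdx y) x t = pdx (pdt y) x t := by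
  have hd : Differentiable ℝ (Function.uncurry y) := hy.differentiable (by simp)
  have h1 := (hasDerivAt_pdt_fderiv ((contDiff_pdx (n := 1) hy).differentiable (by simp)) x t).deriv
  have h2 := (hasDerivAt_pdx_fderiv ((contDiff_pdt (n := 1) hy).differentiable (by simp)) x t).deriv
  have hdd : DifferentiableAt ℝ (fderiv ℝ (Function.uncurry y)) (x, t) :=
    (hy.fderiv_right (m := 1) (by norm_num)).differentiable (by simp) _
  have hs := (hy.contDiffAt (x := (x, t))).isSymmSndFDerivAt (by simp)
  rw [uncurry_pdx hd, fderiv_clm_apply hdd (by fun_prop)] at h1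
  rw [uncurry_pdt hd, fderiv_clm_apply hdd (by fun_prop)] at h2
  simp only [fderiv_fun_const, Pi.zero_apply, ContinuousLinearMap.comp_zero, zero_add,
    ContinuousLinearMap.flip_apply] at h1 h2
  exact h1.trans ((hs.eq _ _).trans h2.symm)

/-- Pointwise Poincaré inequality for a function vanishing at the left endpoint. -/
theorem sq_le_integral_sq_deriv {f f' : ℝ → ℝ} (hf : ∀ x, HasDerivAt f (f' x) x)
    (hf' : Continuous f') (h0 : f 0 = 0) {x : ℝ} (hx : x ∈ Set.Icc (0 : ℝ) 1) :
    f x ^ 2 ≤ ∫ z in (0 : ℝ)..1, f' z ^ 2 := by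
  have hmono : ∫ z in (0 : ℝ)..x, f' z ^ 2 ≤ ∫ z in (0 : ℝ)..1, f' z ^ 2 :=
    intervalIntegral.integral_mono_interval le_rfl hx.1 hx.2
      (Eventually.of_forall fun z => sq_nonneg _) ((hf'.pow 2).intervalIntegrable _ _)
  have hlow : ∫ z in (0 : ℝ)..x, (2 * f x * f' z - f x ^ 2) ≤ ∫ z in (0 : ℝ)..x, f' z ^ 2 := by
    refine intervalIntegral.integral_mono_on hx.1
      (Continuous.intervalIntegrable (by fun_prop) _ _)
      (Continuous.intervalIntegrable (by fun_prop) _ _) fun z _ => ?_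
    nlinarith [sq_nonneg (f' z - f x)]
  have hint : ∫ z in (0 : ℝ)..x, (2 * f x * f' z - f x ^ 2) = 2 * f x ^ 2 - f x ^ 2 * x := by
    rw [intervalIntegral.integral_eq_sub_of_hasDerivAt
      (f := fun z => 2 * f x * f z - f x ^ 2 * z) (fun z _ => ?_)
      (Continuous.intervalIntegrable (by fun_prop) _ _), h0]
    · ring
    · have := ((hf z).const_mul (2 * f x)).sub ((hasDerivAt_id z).const_mul (f x ^ 2))
      rw [mul_one] at this
      exact this
  nlinarith [hx.2, sq_nonneg (f x)]

/-- A nonnegative decay rate in a differential inequality forces exponential decay. -/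
theorem le_mul_exp_of_deriv_le {V V' : ℝ → ℝ} {k : ℝ} {a : ℝ} (hV : ∀ t, HasDerivAt V (V' t) t)
    (h : ∀ t, a < t → V' t ≤ -k * V t) {t : ℝ} (ht : a ≤ t) :
    V t ≤ V a * exp (-k * (t - a)) := by
  have hd : ∀ s, HasDerivAt (fun s => V s * exp (k * (s - a)))
      ((V' s + k * V s) * exp (k * (s - a))) s := fun s => by
    refine ((hV s).mul ((((hasDerivAt_id s).sub_const a).const_mul k).exp)).congr_deriv ?_
    simp only [id]
    ring
  have hanti : AntitoneOn (fun s => V s * exp (k * (s - a))) (Set.Ici a) := by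
    refine antitoneOn_of_deriv_nonpos (convex_Ici a)
      (fun s _ => (hd s).continuousAt.continuousWithinAt)
      (fun s _ => (hd s).differentiableAt.differentiableWithinAt) fun s hs => ?_
    rw [interior_Ici] at hs
    rw [(hd s).deriv]
    exact mul_nonpos_of_nonpos_of_nonneg (by linarith [h s hs]) (exp_pos _).le
  have := hanti (Set.self_mem_Ici (a := a)) ht ht
  simp only [sub_self, mul_zero, exp_zero, mul_one] at this
  calc V t = V t * exp (k * (t - a)) * exp (-k * (t - a)) := by
        rw [mul_assoc, ← exp_add]; simp
    _ ≤ V a * exp (-k * (t - a)) := mul_le_mul_of_nonneg_right this (exp_pos _).le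

/-- Lyapunov density for the moving string with Kelvin–Voigt damping: displacement `y`,
velocity `w`, slope `p`. -/
noncomputable def lyapunovDensity (b δ η c ε y w p : ℝ) : ℝ :=
  w ^ 2 / 2 + c / 2 * p ^ 2 + b / 8 * p ^ 4 + ε * (y * w + δ * y ^ 2 + η / 4 * p ^ 4)

theorem le_lyapunovDensity {b δ η c ε : ℝ} (hb : 0 < b) (hδ : 0 < δ) (hη : 0 < η) (hε : 0 < ε)
    (hεδ : ε ≤ δ) (y w p : ℝ) : c / 2 * p ^ 2 ≤ lyapunovDensity b δ η c ε y w p := by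
  have hsq : lyapunovDensity b δ η c ε y w p - c / 2 * p ^ 2
      = (1 / 2 - ε / (4 * δ)) * w ^ 2 + b / 8 * p ^ 4
        + ε * (δ * (y + w / (2 * δ)) ^ 2 + η / 4 * p ^ 4) := by
    unfold lyapunovDensity
    field_simp
    ring
  have h1 : 0 ≤ 1 / 2 - ε / (4 * δ) := by
    have : ε / (4 * δ) ≤ 1 / 2 := by
      rw [div_le_iff₀ (by positivity)]
      linarith
    linarith
  have : 0 ≤ lyapunovDensity b δ η c ε y w p - c / 2 * p ^ 2 := by
    rw [hsq]
    positivity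
  linarith

theorem lyapunovDensity_le {b δ η c ε : ℝ} (hb : 0 < b) (hη : 0 < η) (hc : 0 < c)
    (hε : 0 < ε) (y w p : ℝ) :
    lyapunovDensity b δ η c ε y w p
      ≤ (1 + c + b + ε + ε * η) * (w ^ 2 + p ^ 2 + p ^ 4) + ε * (δ + 1 / 2) * y ^ 2 := by
  have hsq : (1 + c + b + ε + ε * η) * (w ^ 2 + p ^ 2 + p ^ 4) + ε * (δ + 1 / 2) * y ^ 2
      - lyapunovDensity b δ η c ε y w p
      = ε / 2 * (y - w) ^ 2 + (1 / 2 + c + b + ε / 2 + ε * η) * w ^ 2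
        + (1 + c / 2 + b + ε + ε * η) * p ^ 2
        + (1 + c + 7 / 8 * b + ε + 3 / 4 * (ε * η)) * p ^ 4 := by
    unfold lyapunovDensity
    ring
  have : 0 ≤ ε / 2 * (y - w) ^ 2 + (1 / 2 + c + b + ε / 2 + ε * η) * w ^ 2
        + (1 + c / 2 + b + ε + ε * η) * p ^ 2
        + (1 + c + 7 / 8 * b + ε + 3 / 4 * (ε * η)) * p ^ 4 := by positivity
  linarith

/-- The dissipation terms dominate the quadratic and quartic parts of the energy. -/
theorem dissipation_le {b δ η c ε v : ℝ} (hη : 0 < η) (hc : 0 < c)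
    (hε : 0 < ε) (hv : v ^ 2 ≤ 1) (hεc : ε * (c + 2) = δ * c) (w p q : ℝ) :
    -(2 * δ) * w ^ 2 + ε * w ^ 2 - η * p ^ 2 * q ^ 2 - ε * c * p ^ 2 - ε * b / 2 * p ^ 4
        + 2 * v * ε * p * w
      ≤ -(δ * w ^ 2 + ε * c / 2 * p ^ 2 + ε * b / 2 * p ^ 4) := by
  have hδe : δ = ε * (c + 2) / c := by field_simp; linarith
  have hsq : -(δ * w ^ 2 + ε * c / 2 * p ^ 2 + ε * b / 2 * p ^ 4)
      - (-(2 * δ) * w ^ 2 + ε * w ^ 2 - η * p ^ 2 * q ^ 2 - ε * c * p ^ 2 - ε * b / 2 * p ^ 4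
        + 2 * v * ε * p * w)
      = η * (p * q) ^ 2 + ε * c / 2 * (p - 2 * v / c * w) ^ 2 + 2 * ε * (1 - v ^ 2) / c * w ^ 2 := by
    rw [hδe]
    field_simp
    ring
  have : 0 ≤ 1 - v ^ 2 := by linarith
  have : 0 ≤ η * (p * q) ^ 2 + ε * c / 2 * (p - 2 * v / c * w) ^ 2
      + 2 * ε * (1 - v ^ 2) / c * w ^ 2 := by positivity
  linarith

/-- Zero-input stability: along C³ solutions of the Kelvin–Voigt moving-string
PDE with subcritical speed `v < (√5 − 1)/2`, the displacement `y(x,t)` tends to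
zero as `t → ∞`, for every `x ∈ [0,1]`. -/
theorem stmt_15 (b δ η v : ℝ) (hb : 0 < b) (hδ : 0 < δ) (hη : 0 < η)
    (hv0 : 0 ≤ v) (hv1 : v < (Real.sqrt 5 - 1) / 2)
    (y : ℝ → ℝ → ℝ)
    (hy : ContDiff ℝ 3 (Function.uncurry y))
    (hpde : ∀ x ∈ Set.Ioo (0:ℝ) 1, ∀ t : ℝ, 0 ≤ t →
      pdt (pdt y) x t + 2 * δ * pdt y x t + 2 * v * pdx (pdt y) x t
        = (1 - v ^ 2 + (3/2) * b * (pdx y x t) ^ 2) * pdx (pdx y) x t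
          + 2 * η * pdx y x t * pdx (pdx y) x t * pdx (pdt y) x t
          + η * (pdx y x t) ^ 2 * pdx (pdx (pdt y)) x t)
    (hbc : ∀ t : ℝ, 0 ≤ t → y 0 t = 0 ∧ y 1 t = 0) :
    ∀ x ∈ Set.Icc (0:ℝ) 1, Tendsto (fun t => y x t) atTop (nhds 0) := by
  have hv : v < 1 := by
    have : Real.sqrt 5 < 3 := by
      rw [Real.sqrt_lt' (by norm_num)]
      norm_num
    linarith
  have hc : 0 < 1 - v ^ 2 := by nlinarith
  have hv2 : v ^ 2 ≤ 1 := by linarith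
  have hw : ContDiff ℝ 2 (Function.uncurry (pdt y)) := contDiff_pdt (n := 2) hy
  have hp : ContDiff ℝ 2 (Function.uncurry (pdx y)) := contDiff_pdx (n := 2) hy
  have ha : ContDiff ℝ 1 (Function.uncurry (pdt (pdt y))) := contDiff_pdt (n := 1) hw
  have hq : ContDiff ℝ 1 (Function.uncurry (pdx (pdt y))) := contDiff_pdx (n := 1) hw
  have hr : ContDiff ℝ 1 (Function.uncurry (pdx (pdx y))) := contDiff_pdx (n := 1) hp
  have hs : ContDiff ℝ 0 (Function.uncurry (pdx (pdx (pdt y)))) := contDiff_pdx (n := 0) hq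
  have dty := hasDerivAt_pdt (hy.differentiable (by simp))
  have dtw := hasDerivAt_pdt (hw.differentiable (by simp))
  have dtp : ∀ x t, HasDerivAt (fun s => pdx y x s) (pdx (pdt y) x t) t := fun x t => by
    rw [← pdt_pdx_eq_pdx_pdt (hy.of_le (by norm_num))]
    exact hasDerivAt_pdt (hp.differentiable (by simp)) x t
  have dxy := hasDerivAt_pdx (hy.differentiable (by simp))
  have dxw := hasDerivAt_pdx (hw.differentiable (by simp))
  have dxp := hasDerivAt_pdx (hp.differentiable (by simp))
  have dxq := hasDerivAt_pdx (hq.differentiable (by simp))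
  have wbc : ∀ t : ℝ, 0 < t → pdt y 0 t = 0 ∧ pdt y 1 t = 0 := fun t ht => by
    constructor
    · exact ((hasDerivAt_const t (0 : ℝ)).congr_of_eventuallyEq
        ((lt_mem_nhds ht).mono fun s hs => (hbc s hs.le).1)).deriv
    · exact ((hasDerivAt_const t (0 : ℝ)).congr_of_eventuallyEq
        ((lt_mem_nhds ht).mono fun s hs => (hbc s hs.le).2)).deriv
  replace hy := hy.continuous
  replace hw := hw.continuous
  replace hp := hp.continuous
  replace ha := ha.continuous
  replace hq := hq.continuous
  replace hr := hr.continuous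
  replace hs := hs.continuous
  generalize pdx (pdx (pdt y)) = s at *
  generalize pdx (pdx y) = r at *
  generalize pdx (pdt y) = q at *
  generalize pdt (pdt y) = a at *
  generalize pdx y = p at *
  generalize pdt y = w at *
  set c := 1 - v ^ 2 with hcdef
  have slice : ∀ {g : ℝ → ℝ → ℝ}, Continuous (Function.uncurry g) →
      ∀ t, Continuous (fun x => g x t) := fun hg t =>
    hg.comp (continuous_id.prodMk continuous_const)
  obtain ⟨ε, hε, hεc⟩ : ∃ ε : ℝ, 0 < ε ∧ ε * (c + 2) = δ * c :=
    ⟨δ * c / (c + 2), by positivity, by field_simp⟩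
  have hεδ : ε ≤ δ := by nlinarith
  let g : ℝ → ℝ → ℝ := fun x t => lyapunovDensity b δ η c ε (y x t) (w x t) (p x t)
  let g' : ℝ → ℝ → ℝ := fun x t =>
    w x t * a x t + c * p x t * q x t + b / 2 * p x t ^ 3 * q x t
      + ε * (w x t * w x t + y x t * a x t + 2 * δ * y x t * w x t + η * p x t ^ 3 * q x t)
  have hg : Continuous (Function.uncurry g) := by
    simp only [g, lyapunovDensity, Function.uncurry_def] at *
    fun_prop
  have hg' : Continuous (Function.uncurry g') := by
    simp only [g', Function.uncurry_def] at *
    fun_prop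
  have dtg : ∀ x t, HasDerivAt (fun s => g x s) (g' x t) t := fun x t => by
    have := (((((dtw x t).pow 2).div_const 2).add (((dtp x t).pow 2).const_mul (c / 2))).add
      (((dtp x t).pow 4).const_mul (b / 8))).add
      (((((dty x t).mul (dtw x t)).add (((dty x t).pow 2).const_mul δ)).add
        (((dtp x t).pow 4).const_mul (η / 4))).const_mul ε)
    refine this.congr_deriv ?_
    simp only [g']
    push_cast
    ring
  have dV := hasDerivAt_integral_of_continuous_deriv (a := 0) (b := 1) hg hg' dtg
  let P : ℝ → ℝ := fun t => ∫ x in (0 : ℝ)..1, p x t ^ 2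
  let D : ℝ → ℝ := fun t => ∫ x in (0 : ℝ)..1, (w x t ^ 2 + p x t ^ 2 + p x t ^ 4)
  have poincare : ∀ t, 0 ≤ t → ∀ x ∈ Set.Icc (0 : ℝ) 1, y x t ^ 2 ≤ P t := fun t ht x hx =>
    sq_le_integral_sq_deriv (f := fun x => y x t) (fun x => dxy x t) (slice hp t) (hbc t ht).1 hx
  have P_le_D : ∀ t, P t ≤ D t := fun t => by
    have := slice hp t
    have := slice hw t
    refine intervalIntegral.integral_mono_on zero_le_one
      (Continuous.intervalIntegrable (by fun_prop) _ _)
      (Continuous.intervalIntegrable (by fun_prop) _ _) fun x _ => ?_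
    have h1 : 0 ≤ w x t ^ 2 := by positivity
    have h2 : 0 ≤ p x t ^ 4 := by positivity
    linarith
  have P_le_V : ∀ t, c / 2 * P t ≤ ∫ x in (0 : ℝ)..1, g x t := fun t => by
    have := slice hp t
    rw [← intervalIntegral.integral_const_mul]
    exact intervalIntegral.integral_mono_on zero_le_one
      (Continuous.intervalIntegrable (by fun_prop) _ _)
      ((slice hg t).intervalIntegrable _ _)
      fun x _ => le_lyapunovDensity hb hδ hη hε hεδ _ _ _
  set K : ℝ := (1 + c + b + ε + ε * η) + ε * (δ + 1 / 2) with hK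
  have K_pos : 0 < K := by positivity
  have V_le_D : ∀ t, 0 ≤ t → ∫ x in (0 : ℝ)..1, g x t ≤ K * D t := fun t ht => by
    have := slice hp t
    have := slice hw t
    have h1 : ∫ x in (0 : ℝ)..1, g x t ≤ ∫ x in (0 : ℝ)..1,
        ((1 + c + b + ε + ε * η) * (w x t ^ 2 + p x t ^ 2 + p x t ^ 4)
          + ε * (δ + 1 / 2) * P t) := by
      refine intervalIntegral.integral_mono_on zero_le_one
        ((slice hg t).intervalIntegrable _ _)
        (Continuous.intervalIntegrable (by fun_prop) _ _) fun x hx => ?_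
      have h2 := lyapunovDensity_le (δ := δ) hb hη hc hε (y x t) (w x t) (p x t)
      have h3 := mul_le_mul_of_nonneg_left (poincare t ht x hx)
        (show 0 ≤ ε * (δ + 1 / 2) by positivity)
      exact h2.trans (by linarith)
    rw [intervalIntegral.integral_add (Continuous.intervalIntegrable (by fun_prop) _ _)
      (Continuous.intervalIntegrable (by fun_prop) _ _), intervalIntegral.integral_const_mul,
      intervalIntegral.integral_const] at h1
    have h4 := mul_le_mul_of_nonneg_left (P_le_D t) (show 0 ≤ ε * (δ + 1 / 2) by positivity)
    simp only [sub_zero, one_smul] at h1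
    change _ ≤ _ * D t + _ at h1
    rw [hK, add_mul]
    linarith
  obtain ⟨m, hm, hm1, hm2, hm3⟩ : ∃ m : ℝ, 0 < m ∧ m ≤ δ ∧ m ≤ ε * c / 2 ∧ m ≤ ε * b / 2 :=
    ⟨min δ (min (ε * c / 2) (ε * b / 2)), by positivity, min_le_left _ _,
      (min_le_right _ _).trans (min_le_left _ _), (min_le_right _ _).trans (min_le_right _ _)⟩
  let σ : ℝ → ℝ → ℝ := fun x t => c * p x t + b / 2 * p x t ^ 3 + η * p x t ^ 2 * q x t
  let σ' : ℝ → ℝ → ℝ := fun x t => (c + 3 / 2 * b * p x t ^ 2) * r x t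
    + 2 * η * p x t * r x t * q x t + η * p x t ^ 2 * s x t
  have dxσ : ∀ x t, HasDerivAt (fun z => σ z t) (σ' x t) x := fun x t => by
    have := (((dxp x t).const_mul c).add (((dxp x t).pow 3).const_mul (b / 2))).add
      ((((dxp x t).pow 2).const_mul η).mul (dxq x t))
    refine this.congr_deriv ?_
    simp only [σ', Pi.pow_apply]
    push_cast
    ring
  let Φ : ℝ → ℝ → ℝ := fun x t => (w x t + ε * y x t) * σ x t - v * w x t ^ 2
    - 2 * v * ε * (y x t * w x t)
  let Φ' : ℝ → ℝ → ℝ := fun x t => (q x t + ε * p x t) * σ x t + (w x t + ε * y x t) * σ' x t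
    - 2 * v * w x t * q x t - 2 * v * ε * (p x t * w x t + y x t * q x t)
  have dxΦ : ∀ x t, HasDerivAt (fun z => Φ z t) (Φ' x t) x := fun x t => by
    have := ((((dxw x t).add ((dxy x t).const_mul ε)).mul (dxσ x t)).sub
      (((dxw x t).pow 2).const_mul v)).sub (((dxy x t).mul (dxw x t)).const_mul (2 * v * ε))
    refine this.congr_deriv ?_
    simp only [Φ', Pi.add_apply]
    push_cast
    ring
  have hΦ' : Continuous (Function.uncurry Φ') := by
    simp only [Φ', σ, σ', Function.uncurry_def] at *
    fun_prop
  have V'_le : ∀ t, 0 < t → ∫ x in (0 : ℝ)..1, g' x t ≤ -m * D t := fun t ht => by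
    have := slice hp t
    have := slice hw t
    have hΦt := slice hΦ' t
    have flux : ∫ x in (0 : ℝ)..1, Φ' x t = 0 := by
      rw [intervalIntegral.integral_eq_sub_of_hasDerivAt (f := fun z => Φ z t)
        (fun z _ => dxΦ z t) (hΦt.intervalIntegrable _ _)]
      simp [Φ, wbc t ht, hbc t ht.le]
    calc ∫ x in (0 : ℝ)..1, g' x t
        ≤ ∫ x in (0 : ℝ)..1, (Φ' x t + -m * (w x t ^ 2 + p x t ^ 2 + p x t ^ 4)) := by
          refine intervalIntegral.integral_mono_on_of_le_Ioo zero_le_one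
            ((slice hg' t).intervalIntegrable _ _)
            (Continuous.intervalIntegrable (by fun_prop) _ _) fun x hx => ?_
          have hax : a x t = σ' x t - 2 * δ * w x t - 2 * v * q x t := by
            have := hpde x hx t ht.le
            simp only [σ']
            linarith
          have hdiss := dissipation_le (b := b) hη hc hε hv2 hεc (w x t) (p x t) (q x t)
          have hbal : g' x t = Φ' x t + (-(2 * δ) * w x t ^ 2 + ε * w x t ^ 2
              - η * p x t ^ 2 * q x t ^ 2 - ε * c * p x t ^ 2 - ε * b / 2 * p x t ^ 4
              + 2 * v * ε * p x t * w x t) := by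
            simp only [g', Φ', hax, σ]
            ring
          have h1 := mul_le_mul_of_nonneg_right hm1 (show 0 ≤ w x t ^ 2 by positivity)
          have h2 := mul_le_mul_of_nonneg_right hm2 (show 0 ≤ p x t ^ 2 by positivity)
          have h3 := mul_le_mul_of_nonneg_right hm3 (show 0 ≤ p x t ^ 4 by positivity)
          rw [hbal]
          linarith
      _ = -m * D t := by
          rw [intervalIntegral.integral_add (Continuous.intervalIntegrable (by fun_prop) _ _)
            (Continuous.intervalIntegrable (by fun_prop) _ _), flux,
            intervalIntegral.integral_const_mul, zero_add]
  have V_decay : ∀ t, 0 ≤ t → ∫ x in (0 : ℝ)..1, g x t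
      ≤ (∫ x in (0 : ℝ)..1, g x 0) * exp (-(m / K) * (t - 0)) := fun t ht => by
    refine le_mul_exp_of_deriv_le (V := fun t => ∫ x in (0 : ℝ)..1, g x t) dV
      (fun t ht => (V'_le t ht).trans ?_) ht
    have := mul_le_mul_of_nonneg_left (V_le_D t ht.le) (show 0 ≤ m / K by positivity)
    rw [← mul_assoc, div_mul_cancel₀ _ K_pos.ne'] at this
    linarith
  intro x hx
  have hexp : Tendsto (fun t : ℝ => 2 / c * ((∫ x in (0 : ℝ)..1, g x 0)
      * exp (-(m / K) * (t - 0)))) atTop (nhds 0) := by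
    have h1 : Tendsto (fun t : ℝ => -(m / K) * (t - 0)) atTop atBot := by
      simp only [sub_zero]
      exact tendsto_id.const_mul_atTop_of_neg (by linarith [div_pos hm K_pos])
    simpa using ((tendsto_exp_atBot.comp h1).const_mul (∫ x in (0 : ℝ)..1, g x 0)).const_mul (2 / c)
  have hsq : Tendsto (fun t => y x t ^ 2) atTop (nhds 0) := by
    refine squeeze_zero' (Eventually.of_forall fun t => sq_nonneg _)
      ((eventually_ge_atTop 0).mono fun t ht => ?_) hexp
    have h1 := mul_le_mul_of_nonneg_left ((P_le_V t).trans (V_decay t ht))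
      (show 0 ≤ 2 / c by positivity)
    have h2 : 2 / c * (c / 2 * P t) = P t := by field_simp
    linarith [poincare t ht x hx]
  have habs := hsq.sqrt
  simp only [Real.sqrt_sq_eq_abs, Real.sqrt_zero] at habs
  exact (tendsto_zero_iff_abs_tendsto_zero _).2 habs
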